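/- Suppose Assumption 1 holds, f ∈ S⁰_{μ_f}(X) and g ∈ S⁰_{μ_g}(Y) with μ_f, μ_g ≥ 0, β_k → ∞, (ε_k) is nonincreasing with ε_k ≥ 0, Σ_{k=1}^{∞} α_kε_k < +∞ and β_kε_k → +∞, and let (x_k, y_k, λ_k) be generated by the scheme (disc) with the implicit multiplier choice λ̄_{k+1} = λ̂_{k+1} = λ_{k+1} (Algorithm 1). Let (x̄*, ȳ*) be the minimal norm solution and λ̄* a dual multiplier with (x̄*, ȳ*, λ̄*) a saddle point of L. Then liminf_{k→∞} ‖(x_k, y_k) − (x̄*, ȳ*)‖ = 0, where ‖(x,y)‖² = ‖x‖² + ‖y‖². -/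

import Mathlib

open Filter Topology
open scoped RealInnerProductSpace

/-- One proximal step for a single block: decrease of the block part of the energy. -/
lemma block_energy_step {H : Type*} [NormedAddCommGroup H] [InnerProductSpace ℝ H]
    (f : H → ℝ) {α β δ γ ε μ : ℝ} (hα : 0 < α) (hβ : 0 < β) (hδ : 0 < δ) (hε : 0 ≤ ε)
    (hμ : 0 ≤ μ) (hδγ : 0 ≤ δ * γ - 1) {x₀ x₁ Z₀ Z₁ u p : H} (xs : H)
    (hf : ∀ w, f w - f x₁ - ⟪u, w - x₁⟫ ≥ μ / 2 * ‖w - x₁‖ ^ 2)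
    (hZ : Z₁ = (1 / α) • (x₁ - x₀) + γ • x₁)
    (hstep : (1 / α) • (Z₁ - Z₀) =
      -(β • (u + p + ε • x₁ - μ • (x₁ - (δ • Z₁ + (1 - δ * γ) • x₁))))) :
    1 / 2 * ‖δ • Z₁ + (1 - δ * γ) • x₁ - xs‖ ^ 2 + (δ * γ - 1) / 2 * ‖x₁ - xs‖ ^ 2 ≤
      1 / 2 * ‖δ • Z₀ + (1 - δ * γ) • x₀ - xs‖ ^ 2 + (δ * γ - 1) / 2 * ‖x₀ - xs‖ ^ 2
      - δ * α * β * (f x₁ - f xs + ε / 2 * (‖x₁‖ ^ 2 - ‖xs‖ ^ 2))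
      - δ ^ 2 * β * (f x₁ - f x₀ + ε / 2 * (‖x₁‖ ^ 2 - ‖x₀‖ ^ 2))
      - δ * α * β * ⟪p, δ • Z₁ + (1 - δ * γ) • x₁ - xs⟫ := by
  obtain ⟨a, rfl⟩ : ∃ a, xs = x₁ - a := ⟨x₁ - xs, by abel⟩
  obtain ⟨d, rfl⟩ : ∃ d, x₀ = x₁ - d := ⟨x₁ - x₀, by abel⟩
  obtain ⟨κ, hκ⟩ : ∃ κ, κ = δ / α := ⟨_, rfl⟩
  have hκα : κ * α = δ := by rw [hκ]; field_simp
  have hκ0 : 0 < κ := by rw [hκ]; positivity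
  have hW₁ : δ • Z₁ + (1 - δ * γ) • x₁ = x₁ + κ • d := by
    rw [hZ, hκ, div_eq_mul_one_div]; module
  rw [hW₁] at hstep ⊢
  obtain ⟨v, hv⟩ : ∃ v, v = u + p + ε • x₁ + (μ * κ) • d := ⟨_, rfl⟩
  have hZZ : Z₀ = Z₁ + (α * β) • v := by
    have h := congrArg (fun t => α • t) hstep
    simp only [smul_smul, mul_one_div_cancel hα.ne', one_smul] at h
    rw [← sub_sub_cancel Z₁ Z₀, h, hv]
    module
  obtain ⟨D, hD⟩ : ∃ D, D = (δ * α * β) • v + (δ * γ - 1) • d := ⟨_, rfl⟩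
  have hW₀ : δ • Z₀ + (1 - δ * γ) • (x₁ - d) - (x₁ - a) = (a + κ • d) + D := by
    have : δ • Z₀ + (1 - δ * γ) • (x₁ - d) = (δ • Z₁ + (1 - δ * γ) • x₁) + D := by
      rw [hZZ, hD]; module
    rw [this, hW₁]; abel
  have hs := hf (x₁ - a)
  have hd := hf (x₁ - d)
  have e1 : x₁ + κ • d - (x₁ - a) = a + κ • d := by abel
  have e2 : x₁ - (x₁ - a) = a := by abel
  have e3 : x₁ - d - (x₁ - a) = a - d := by abel
  have e4 : x₁ - a - x₁ = -a := by abel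
  have e5 : x₁ - d - x₁ = -d := by abel
  rw [hW₀, e1, e2, e3]
  rw [e4, inner_neg_right, norm_neg] at hs
  rw [e5, inner_neg_right, norm_neg] at hd
  have hDin : ⟪a + κ • d, D⟫ = δ * α * β * (⟪u, a⟫ + κ * ⟪u, d⟫ + ⟪p, a + κ • d⟫
      + ε * (⟪x₁, a⟫ + κ * ⟪x₁, d⟫) + μ * κ * (⟪a, d⟫ + κ * ‖d‖ ^ 2))
      + (δ * γ - 1) * (⟪a, d⟫ + κ * ‖d‖ ^ 2) := by
    rw [hD, hv]
    simp only [inner_add_left, inner_add_right, real_inner_smul_left, real_inner_smul_right,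
      real_inner_self_eq_norm_sq]
    rw [real_inner_comm u a, real_inner_comm u d, real_inner_comm p a, real_inner_comm p d,
      real_inner_comm x₁ a, real_inner_comm x₁ d]
    ring
  have hμsq : 0 ≤ ‖a + κ • d‖ ^ 2 := by positivity
  rw [norm_add_sq_real (a + κ • d) D, hDin, norm_sub_sq_real a d, norm_sub_sq_real x₁ a,
    norm_sub_sq_real x₁ d]
  rw [norm_add_sq_real a, norm_smul, inner_smul_right, mul_pow, Real.norm_eq_abs, sq_abs] at hμsq
  have h1 := mul_le_mul_of_nonneg_left hs (by positivity : 0 ≤ δ * α * β)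
  have h2 := mul_le_mul_of_nonneg_left hd (by positivity : 0 ≤ δ * α * β * κ)
  have h3 := mul_nonneg (by positivity : 0 ≤ δ * α * β * μ / 2) hμsq
  have hδ2 : δ ^ 2 * β = δ * α * β * κ := by rw [← hκα]; ring
  rw [hδ2]
  have p1 : 0 ≤ ‖D‖ ^ 2 := by positivity
  have p2 : 0 ≤ (δ * γ - 1) * (κ * ‖d‖ ^ 2) := by positivity
  have p3 : 0 ≤ (δ * γ - 1) * ‖d‖ ^ 2 := by positivity
  have p4 : 0 ≤ δ * α * β * ε * ‖a‖ ^ 2 := by positivity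
  have p5 : 0 ≤ δ * α * β * ε * κ * ‖d‖ ^ 2 := by positivity
  have p6 : 0 ≤ δ * α * β * μ * κ * ‖d‖ ^ 2 := by positivity
  have p7 : 0 ≤ δ * α * β * μ * κ ^ 2 * ‖d‖ ^ 2 := by positivity
  linarith

/-- A weighted Kronecker-type lemma. -/
lemma tendsto_weighted_sum_div {a β : ℕ → ℝ} (ha : ∀ k, 0 ≤ a k) (hs : Summable a)
    (hβ : ∀ k, 0 < β k) (hmono : Monotone β) (htop : Tendsto β atTop atTop) :
    Tendsto (fun n => (∑ k ∈ Finset.range n, β k * a k) / β n) atTop (𝓝 0) := by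
  have h := tendsto_tsum_of_dominated_convergence (𝓕 := atTop)
    (f := fun n k => if k < n then β k * a k / β n else 0) (g := fun _ => (0 : ℝ)) hs
    (fun k => by
      refine (squeeze_zero (g := fun n => β k * a k / β n) (fun n => ?_) (fun n => ?_)
        (htop.const_div_atTop _))
      · have := ha k; have := hβ k; have := hβ n
        split_ifs <;> positivity
      · have := ha k; have := hβ k; have := hβ n
        split_ifs
        · exact le_rfl
        · positivity)
    (Eventually.of_forall fun n k => by
      have h1 := ha k; have h2 := hβ k; have h3 := hβ n
      split_ifs with hkn
      · rw [Real.norm_of_nonneg (by positivity), div_le_iff₀ h3, mul_comm]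
        exact mul_le_mul_of_nonneg_left (hmono hkn.le) h1
      · simpa using h1)
  rw [tsum_zero] at h
  refine h.congr fun n => ?_
  rw [tsum_eq_sum (s := Finset.range n) (fun k hk => if_neg (by simpa using hk)), Finset.sum_div]
  exact Finset.sum_congr rfl fun k hk => if_pos (by simpa using hk)

/-- Residuals driven by slowly growing multipliers vanish. -/
lemma tendsto_residual_zero {Z : Type*} [NormedAddCommGroup Z] [NormedSpace ℝ Z]
    {α β σ : ℕ → ℝ} {δ : ℝ} {r s : ℕ → Z} (hδ : 0 < δ) (hα : ∀ k, 0 < α k) (hβ : ∀ k, 0 < β k)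
    (hββ : ∀ k, δ * β (k + 1) ≤ (α k + δ) * β k) (htop : Tendsto β atTop atTop)
    (hσ : Monotone σ) (hsσ : ∀ k, ‖s k‖ ≤ σ k)
    (hlim : Tendsto (fun k => σ k / β k) atTop (𝓝 0))
    (hr : ∀ k, ((α k + δ) * β k) • r (k + 1) = (δ * β k) • r k + (s (k + 1) - s k)) :
    Tendsto r atTop (𝓝 0) := by
  have hτ : ∀ n, ‖(δ * β n) • r n - s n‖ ≤ ‖(δ * β 0) • r 0 - s 0‖ + σ n := by
    intro n
    induction n with
    | zero => linarith [norm_nonneg (s 0), hsσ 0]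
    | succ k ih =>
      have hc : 0 < (α k + δ) * β k := by have := hα k; have := hβ k; positivity
      obtain ⟨θ, hθ⟩ : ∃ θ, θ = δ * β (k + 1) / ((α k + δ) * β k) := ⟨_, rfl⟩
      have hθ0 : 0 ≤ θ := by rw [hθ]; have := hβ (k + 1); positivity
      have hθ1 : θ ≤ 1 := by rw [hθ, div_le_one hc]; exact hββ k
      have e : (δ * β (k + 1)) • r (k + 1) - s (k + 1) =
          θ • ((δ * β k) • r k - s k) + (-(1 - θ)) • s (k + 1) := by
        have h1 : (δ * β (k + 1)) • r (k + 1) = θ • (((α k + δ) * β k) • r (k + 1)) := by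
          rw [smul_smul, hθ, div_mul_cancel₀ _ hc.ne']
        rw [h1, hr]; module
      have hσk := hσ k.le_succ
      have hsk := hsσ (k + 1)
      have hn := norm_nonneg ((δ * β 0) • r 0 - s 0)
      calc _ ≤ ‖θ • ((δ * β k) • r k - s k)‖ + ‖(-(1 - θ)) • s (k + 1)‖ := by
            rw [e]; exact norm_add_le _ _
        _ = θ * ‖(δ * β k) • r k - s k‖ + (1 - θ) * ‖s (k + 1)‖ := by
            rw [norm_smul, norm_smul, norm_neg, Real.norm_of_nonneg hθ0,
              Real.norm_of_nonneg (sub_nonneg.2 hθ1)]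
        _ ≤ θ * (‖(δ * β 0) • r 0 - s 0‖ + σ (k + 1)) +
            (1 - θ) * (‖(δ * β 0) • r 0 - s 0‖ + σ (k + 1)) :=
            add_le_add (mul_le_mul_of_nonneg_left (ih.trans (by gcongr)) hθ0)
              (mul_le_mul_of_nonneg_left (by linarith) (sub_nonneg.2 hθ1))
        _ = _ := by ring
  refine squeeze_zero_norm (a := fun n => ‖(δ * β 0) • r 0 - s 0‖ / δ / β n + 2 / δ * (σ n / β n))
    (fun n => ?_) ?_
  · have h0 := hβ n
    have h1 : ‖(δ * β n) • r n‖ ≤ ‖(δ * β n) • r n - s n‖ + ‖s n‖ := by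
      simpa using norm_add_le ((δ * β n) • r n - s n) (s n)
    rw [norm_smul, Real.norm_of_nonneg (by positivity)] at h1
    have h2 := hτ n
    have h3 := hsσ n
    have e : ‖(δ * β 0) • r 0 - s 0‖ / δ / β n + 2 / δ * (σ n / β n) =
      (‖(δ * β 0) • r 0 - s 0‖ + 2 * σ n) / (δ * β n) := by field_simp
    rw [e, le_div_iff₀ (by positivity)]
    linarith
  · simpa using (htop.const_div_atTop (‖(δ * β 0) • r 0 - s 0‖ / δ)).add (hlim.const_mul (2 / δ))

/-- Tykhonov well-posedness of norm minimization over the zero set of a convex function. -/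
lemma exists_forall_norm_sub_lt_of_minimal_norm {E : Type*} [NormedAddCommGroup E]
    [InnerProductSpace ℝ E] [CompleteSpace E] {p : E → ℝ} (hconv : ConvexOn ℝ Set.univ p)
    (hcont : Continuous p) {zs : E} (hzs : p zs ≤ 0) (hmin : ∀ z, p z ≤ 0 → ‖zs‖ ≤ ‖z‖)
    {η : ℝ} (hη : 0 < η) :
    ∃ t > 0, ∀ z, p z ≤ t → ‖z‖ ^ 2 ≤ ‖zs‖ ^ 2 + t → ‖z - zs‖ < η := by
  have hproj : ∀ n : ℕ, ∃ a, p a ≤ 1 / ((n : ℝ) + 1) ∧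
      ∀ w, p w ≤ 1 / ((n : ℝ) + 1) → ‖w - a‖ ^ 2 ≤ ‖w‖ ^ 2 - ‖a‖ ^ 2 := by
    intro n
    have hC : Convex ℝ {z | p z ≤ 1 / ((n : ℝ) + 1)} := by
      simpa using hconv.convex_le (1 / ((n : ℝ) + 1))
    have hcl : IsClosed {z | p z ≤ 1 / ((n : ℝ) + 1)} := isClosed_le hcont continuous_const
    have hzn : p zs ≤ 1 / ((n : ℝ) + 1) := hzs.trans (by positivity)
    obtain ⟨a, ha, hinf⟩ := exists_norm_eq_iInf_of_complete_convex ⟨zs, hzn⟩ hcl.isComplete hC 0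
    refine ⟨a, ha, fun w hw => ?_⟩
    have h := (norm_eq_iInf_iff_real_inner_le_zero hC ha).1 hinf w hw
    rw [zero_sub, inner_neg_left, inner_sub_right, real_inner_self_eq_norm_sq] at h
    rw [norm_sub_sq_real, real_inner_comm]
    linarith
  choose a ha hpa using hproj
  have hanti : ∀ {m n : ℕ}, n ≤ m → p (a m) ≤ 1 / ((n : ℝ) + 1) := fun {m n} h =>
    (ha m).trans (one_div_le_one_div_of_le (by positivity) (by gcongr))
  have hzn : ∀ n : ℕ, ‖zs - a n‖ ^ 2 ≤ ‖zs‖ ^ 2 - ‖a n‖ ^ 2 := fun n =>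
    hpa n zs (hzs.trans (by positivity))
  have hmono : Monotone fun n => ‖a n‖ ^ 2 := fun n m h => by
    have := hpa n (a m) (hanti h)
    simp only
    linarith [sq_nonneg ‖a m - a n‖]
  have hbdd : BddAbove (Set.range fun n => ‖a n‖ ^ 2) := ⟨‖zs‖ ^ 2, by
    rintro _ ⟨n, rfl⟩
    simp only
    linarith [hzn n, sq_nonneg ‖zs - a n‖]⟩
  have hlim := tendsto_atTop_ciSup hmono hbdd
  have hcau : CauchySeq a := by
    rw [Metric.cauchySeq_iff']
    intro e he
    obtain ⟨N, hN⟩ := Metric.cauchySeq_iff'.1 hlim.cauchySeq (e ^ 2) (by positivity)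
    refine ⟨N, fun n hn => ?_⟩
    have h1 := hpa N (a n) (hanti hn)
    have h2 := (le_abs_self _).trans_lt (hN n hn)
    rw [dist_eq_norm]
    exact lt_of_pow_lt_pow_left₀ 2 he.le (h1.trans_lt h2)
  obtain ⟨l, hl⟩ := cauchySeq_tendsto_of_complete hcau
  have hpl : p l ≤ 0 := le_of_tendsto_of_tendsto ((hcont.tendsto l).comp hl)
    tendsto_one_div_add_atTop_nhds_zero_nat (Eventually.of_forall ha)
  have hnl : Tendsto (fun n => ‖zs‖ ^ 2 - ‖a n‖ ^ 2) atTop (𝓝 (‖zs‖ ^ 2 - ‖l‖ ^ 2)) :=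
    (hl.norm.pow 2).const_sub _
  have hle : ‖zs‖ ^ 2 - ‖l‖ ^ 2 ≤ 0 := by
    have := pow_le_pow_left₀ (norm_nonneg _) (hmin l hpl) 2
    linarith
  have hev : ∀ᶠ n : ℕ in atTop, ‖zs‖ ^ 2 - ‖a n‖ ^ 2 < η ^ 2 / 8 :=
    hnl.eventually_lt_const (by have := sq_pos_of_pos hη; linarith)
  obtain ⟨n, hn⟩ := hev.exists
  have hη2 : 0 < η ^ 2 := by positivity
  refine ⟨min (1 / ((n : ℝ) + 1)) (η ^ 2 / 8), lt_min (by positivity) (by positivity),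
    fun z hz hz2 => ?_⟩
  have h1 := hpa n z (hz.trans (min_le_left _ _))
  have h2 := hzn n
  have h3 : ‖z‖ ^ 2 ≤ ‖zs‖ ^ 2 + η ^ 2 / 8 := hz2.trans (by gcongr; exact min_le_right _ _)
  have h4 : ‖z - a n‖ < η / 2 := lt_of_pow_lt_pow_left₀ 2 (by positivity) (by linarith)
  have h5 : ‖zs - a n‖ < η / 2 := lt_of_pow_lt_pow_left₀ 2 (by positivity) (by linarith)
  have h6 := norm_sub_le (z - a n) (zs - a n)
  rw [sub_sub_sub_cancel_right] at h6
  linarith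

lemma liminf_eq_zero_of_frequently_lt {u : ℕ → ℝ} (h0 : ∀ k, 0 ≤ u k)
    (h : ∀ η > 0, ∃ᶠ k in atTop, u k < η) : liminf u atTop = 0 := by
  have hb : IsBoundedUnder (· ≥ ·) atTop u := ⟨0, eventually_map.2 (Eventually.of_forall h0)⟩
  refine le_antisymm (le_of_forall_pos_le_add fun η hη => ?_) ?_
  · rw [zero_add]
    exact liminf_le_of_frequently_le ((h η hη).mono fun _ hk => hk.le) hb
  · refine le_liminf_of_le ?_ (Eventually.of_forall h0)
    exact IsCoboundedUnder.of_frequently_le ((h 1 one_pos).mono fun _ hk => hk.le)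

lemma energy_step_le {α β β' δ ε ε' G G' N N' Q Q' : ℝ} (hδ : 0 < δ) (hβ : 0 < β)
    (hββ : δ * β' ≤ (α + δ) * β) (hε : ε' ≤ ε) (c : ℝ) (hcN : 0 ≤ N' - c)
    (hψ : 0 ≤ G' + ε' / 2 * (N' - c)) (Ns : ℝ)
    (hstep : Q' ≤ Q - δ * α * β * (G' + ε / 2 * (N' - Ns))
      - δ ^ 2 * β * (G' - G + ε / 2 * (N' - N))) (hα : 0 < α) :
    Q' + δ ^ 2 * β' * (G' + ε' / 2 * (N' - c)) ≤
      Q + δ ^ 2 * β * (G + ε / 2 * (N - c)) + δ / 2 * (Ns - c) * (β * (α * ε)) := by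
  have h1 := mul_le_mul_of_nonneg_right (mul_le_mul_of_nonneg_left hββ hδ.le) hψ
  have h2 : G' + ε' / 2 * (N' - c) ≤ G' + ε / 2 * (N' - c) := by gcongr
  have h3 := mul_le_mul_of_nonneg_left h2 (by positivity : 0 ≤ δ * ((α + δ) * β))
  linarith

section Energy

variable {α β ε G N Q : ℕ → ℝ} {δ Ns : ℝ}

lemma energy_growth (hδ : 0 < δ) (hα : ∀ k, 0 < α k) (hβ : ∀ k, 0 < β k)
    (hββ : ∀ k, δ * β (k + 1) ≤ (α k + δ) * β k) (hε0 : ∀ k, 0 ≤ ε k) (hε : Antitone ε)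
    (hG : ∀ k, 0 ≤ G k) (hN : ∀ k, 0 ≤ N k)
    (hstep : ∀ k, Q (k + 1) ≤ Q k - δ * α k * β k * (G (k + 1) + ε k / 2 * (N (k + 1) - Ns))
      - δ ^ 2 * β k * (G (k + 1) - G k + ε k / 2 * (N (k + 1) - N k))) (n : ℕ) :
    Q n + δ ^ 2 * β n * (G n + ε n / 2 * N n) ≤ Q 0 + δ ^ 2 * β 0 * (G 0 + ε 0 / 2 * N 0)
      + δ / 2 * Ns * ∑ k ∈ Finset.range n, β k * (α k * ε k) := by
  induction n with
  | zero => simp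
  | succ k ih =>
    have h0 : 0 ≤ G (k + 1) + ε (k + 1) / 2 * (N (k + 1) - 0) := by
      have := hG (k + 1); have := hε0 (k + 1); have := hN (k + 1)
      rw [sub_zero]; positivity
    have h := energy_step_le hδ (hβ k) (hββ k) (hε k.le_succ) 0 (by simpa using hN (k + 1)) h0 Ns
      (hstep k) (hα k)
    simp only [sub_zero] at h
    rw [Finset.sum_range_succ, mul_add]
    linarith

lemma frequently_lt_add_of_energy (hδ : 0 < δ) (hα : ∀ k, 0 < α k) (hβ : ∀ k, 0 < β k)
    (hββ : ∀ k, δ * β (k + 1) ≤ (α k + δ) * β k) (hε0 : ∀ k, 0 ≤ ε k) (hε : Antitone ε)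
    (hβε : Tendsto (fun k => β k * ε k) atTop atTop) (hG : ∀ k, 0 ≤ G k) (hQ : ∀ k, 0 ≤ Q k)
    (hstep : ∀ k, Q (k + 1) ≤ Q k - δ * α k * β k * (G (k + 1) + ε k / 2 * (N (k + 1) - Ns))
      - δ ^ 2 * β k * (G (k + 1) - G k + ε k / 2 * (N (k + 1) - N k)))
    {η : ℝ} (hη : 0 < η) : ∃ᶠ k in atTop, N k < Ns + η := by
  intro hcon
  obtain ⟨K, hK⟩ := eventually_atTop.1 hcon
  have hN : ∀ k ≥ K, η ≤ N k - Ns := fun k hk => by linarith [not_lt.1 (hK k hk)]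
  obtain ⟨C, hC⟩ : ∃ C, C = Q K + δ ^ 2 * β K * (G K + ε K / 2 * (N K - Ns)) := ⟨_, rfl⟩
  have hE : ∀ k ≥ K, Q k + δ ^ 2 * β k * (G k + ε k / 2 * (N k - Ns)) ≤ C := by
    intro k hk
    induction k, hk using Nat.le_induction with
    | base => exact hC.ge
    | succ k hk ih =>
      have hNk : 0 ≤ N (k + 1) - Ns := hη.le.trans (hN (k + 1) (by omega))
      have h0 : 0 ≤ G (k + 1) + ε (k + 1) / 2 * (N (k + 1) - Ns) := by
        have := hG (k + 1); have := hε0 (k + 1); positivity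
      have h := energy_step_le hδ (hβ k) (hββ k) (hε k.le_succ) Ns hNk h0 Ns (hstep k) (hα k)
      rw [sub_self, mul_zero, zero_mul, add_zero] at h
      exact h.trans ih
  obtain ⟨k, hkK, hk⟩ := ((eventually_ge_atTop K).and
    (hβε.eventually_gt_atTop (2 * C / (δ ^ 2 * η)))).exists
  rw [div_lt_iff₀ (by positivity)] at hk
  have h1 := hE k hkK
  have h2 := hQ k
  have h3 : 0 ≤ δ ^ 2 * β k * G k := by have := hβ k; have := hG k; positivity
  have h4 := mul_le_mul_of_nonneg_left (hN k hkK)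
    (by have := hβ k; have := hε0 k; positivity : 0 ≤ δ ^ 2 * β k * ε k / 2)
  linarith

/-- Objective gap and residual both vanish along the iterates. -/
lemma tendsto_gap_and_residual {Z : Type*} [NormedAddCommGroup Z] [NormedSpace ℝ Z] {r s : ℕ → Z}
    (hδ : 0 < δ) (hα : ∀ k, 0 < α k) (hβ : ∀ k, 0 < β k)
    (hββ : ∀ k, δ * β (k + 1) ≤ (α k + δ) * β k) (hβmono : Monotone β)
    (hβtop : Tendsto β atTop atTop) (hε0 : ∀ k, 0 ≤ ε k) (hε : Antitone ε)
    (hsum : Summable fun k => α k * ε k) (hG : ∀ k, 0 ≤ G k) (hN : ∀ k, 0 ≤ N k) (hNs : 0 ≤ Ns)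
    (hQ : ∀ k, δ / 2 * ‖s k‖ ^ 2 ≤ Q k)
    (hstep : ∀ k, Q (k + 1) ≤ Q k - δ * α k * β k * (G (k + 1) + ε k / 2 * (N (k + 1) - Ns))
      - δ ^ 2 * β k * (G (k + 1) - G k + ε k / 2 * (N (k + 1) - N k)))
    (hr : ∀ k, ((α k + δ) * β k) • r (k + 1) = (δ * β k) • r k + (s (k + 1) - s k)) :
    Tendsto G atTop (𝓝 0) ∧ Tendsto r atTop (𝓝 0) := by
  obtain ⟨M, hM⟩ : ∃ M : ℕ → ℝ, M = fun n => Q 0 + δ ^ 2 * β 0 * (G 0 + ε 0 / 2 * N 0)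
      + δ / 2 * Ns * ∑ k ∈ Finset.range n, β k * (α k * ε k) := ⟨_, rfl⟩
  have hterm : ∀ k, 0 ≤ α k * ε k := fun k => mul_nonneg (hα k).le (hε0 k)
  have hMlim : Tendsto (fun n => M n / β n) atTop (𝓝 0) := by
    have h := (hβtop.const_div_atTop (Q 0 + δ ^ 2 * β 0 * (G 0 + ε 0 / 2 * N 0))).add
      ((tendsto_weighted_sum_div hterm hsum hβ hβmono hβtop).const_mul (δ / 2 * Ns))
    rw [mul_zero, add_zero] at h
    refine h.congr fun n => ?_
    rw [hM]; ring
  have hMmono : Monotone M := by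
    refine monotone_nat_of_le_succ fun n => ?_
    have : 0 ≤ δ / 2 * Ns * (β n * (α n * ε n)) := by
      have := hβ n; have := hterm n; positivity
    simp only [hM, Finset.sum_range_succ, mul_add]
    linarith
  have hE : ∀ n, Q n + δ ^ 2 * β n * (G n + ε n / 2 * N n) ≤ M n := fun n => by
    rw [hM]; exact energy_growth hδ hα hβ hββ hε0 hε hG hN hstep n
  have hεN : ∀ n, 0 ≤ δ ^ 2 * β n * (ε n / 2 * N n) := fun n => by
    have := hβ n; have := hε0 n; have := hN n; positivity
  constructor
  · refine squeeze_zero hG (fun n => ?_) (by simpa using hMlim.const_mul (1 / δ ^ 2))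
    have h1 := hE n
    have h2 := hεN n
    have h3 : 0 ≤ δ / 2 * ‖s n‖ ^ 2 := by positivity
    have h4 := hQ n
    have h5 := hβ n
    rw [div_mul_div_comm, one_mul, le_div_iff₀ (by positivity)]
    linarith
  · refine tendsto_residual_zero (σ := fun n => 1 + 2 / δ * M n) hδ hα hβ hββ hβtop
      (fun m n h => by have := hMmono h; simp only; gcongr) (fun n => ?_) ?_ hr
    · have h1 := hE n
      have h2 := hεN n
      have h3 : 0 ≤ δ ^ 2 * β n * G n := by have := hβ n; have := hG n; positivity
      have h4 := hQ n
      have h5 : ‖s n‖ ^ 2 ≤ 2 / δ * M n := by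
        rw [div_mul_eq_mul_div, le_div_iff₀ hδ]; linarith
      nlinarith [sq_nonneg (‖s n‖ - 1)]
    · have h := (hβtop.const_div_atTop 1).add (hMlim.const_mul (2 / δ))
      rw [mul_zero, add_zero] at h
      refine h.congr fun n => ?_
      ring

end Energy

section Product

variable {X Y Z : Type*}
    [NormedAddCommGroup X] [InnerProductSpace ℝ X] [NormedAddCommGroup Y] [InnerProductSpace ℝ Y]
    [NormedAddCommGroup Z] [InnerProductSpace ℝ Z]

lemma convexOn_lagrangian_add_norm_residual {f : X → ℝ} {g : Y → ℝ}
    (hf : ConvexOn ℝ Set.univ f) (hg : ConvexOn ℝ Set.univ g)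
    (A : X →L[ℝ] Z) (B : Y →L[ℝ] Z) (b l : Z) (c : ℝ) :
    ConvexOn ℝ Set.univ fun z : WithLp 2 (X × Y) =>
      (f z.fst + g z.snd + ⟪l, A z.fst + B z.snd - b⟫ - c) + ‖A z.fst + B z.snd - b‖ := by
  refine ⟨convex_univ, fun z _ w _ s t hs ht hst => ?_⟩
  have hR : A (s • z + t • w).fst + B (s • z + t • w).snd - b =
      s • (A z.fst + B z.snd - b) + t • (A w.fst + B w.snd - b) := by
    have hb : b = (s + t) • b := by rw [hst, one_smul]
    nth_rewrite 1 [hb]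
    simp only [WithLp.add_fst, WithLp.add_snd, WithLp.smul_fst, WithLp.smul_snd, map_add, map_smul]
    module
  have h1 := hf.2 (Set.mem_univ z.fst) (Set.mem_univ w.fst) hs ht hst
  have h2 := hg.2 (Set.mem_univ z.snd) (Set.mem_univ w.snd) hs ht hst
  have h3 := norm_add_le (s • (A z.fst + B z.snd - b)) (t • (A w.fst + B w.snd - b))
  rw [norm_smul, norm_smul, Real.norm_of_nonneg hs, Real.norm_of_nonneg ht] at h3
  simp only [WithLp.add_fst, WithLp.add_snd, WithLp.smul_fst, WithLp.smul_snd, smul_eq_mul] at h1 h2 hR ⊢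
  rw [hR, inner_add_right, real_inner_smul_right, real_inner_smul_right]
  have hc : c = s * c + t * c := by rw [← add_mul, hst, one_mul]
  linarith

end Product

theorem liminf_to_minimal_norm_solution_algorithm1
    {X Y Z : Type*}
    [NormedAddCommGroup X] [InnerProductSpace ℝ X] [CompleteSpace X]
    [NormedAddCommGroup Y] [InnerProductSpace ℝ Y] [CompleteSpace Y]
    [NormedAddCommGroup Z] [InnerProductSpace ℝ Z] [CompleteSpace Z]
    (f : X → ℝ) (g : Y → ℝ)
    (hfconv : ConvexOn ℝ Set.univ f) (hfcont : Continuous f)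
    (hgconv : ConvexOn ℝ Set.univ g) (hgcont : Continuous g)
    (A : X →L[ℝ] Z) (B : Y →L[ℝ] Z) (b : Z)
    (μf μg : ℝ) (hμf : 0 ≤ μf) (hμg : 0 ≤ μg)
    (hfS : ∀ x u v : X, (∀ w, f w - f x ≥ ⟪v, w - x⟫) →
        f u - f x - ⟪v, u - x⟫ ≥ μf / 2 * ‖u - x‖ ^ 2)
    (hgS : ∀ y u v : Y, (∀ w, g w - g y ≥ ⟪v, w - y⟫) →
        g u - g y - ⟪v, u - y⟫ ≥ μg / 2 * ‖u - y‖ ^ 2)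
    (L : X → Y → Z → ℝ)
    (hL : ∀ x y l, L x y l = f x + g y + ⟪l, A x + B y - b⟫)
    (δ γ : ℝ) (hδ : 0 < δ) (hγ : 0 < γ)
    (α β ε : ℕ → ℝ)
    (hα : ∀ k, 1 ≤ k → 0 < α k)
    (hβpos : ∀ k, 1 ≤ k → 0 < β k)
    (hβmono : ∀ k, 1 ≤ k → β k ≤ β (k + 1))
    (hεnn : ∀ k, 1 ≤ k → 0 ≤ ε k)
    (hβtop : Tendsto β atTop atTop)
    (x : ℕ → X) (y : ℕ → Y) (lam : ℕ → Z)
    (Zs Zd : ℕ → X) (Hs Hd : ℕ → Y)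
    (hZ : ∀ k, 1 ≤ k → Zs (k + 1) = (1 / α k) • (x (k + 1) - x k) + γ • x (k + 1))
    (hZd : ∀ k, 1 ≤ k → Zd (k + 1) = δ • Zs (k + 1) + (1 - δ * γ) • x (k + 1))
    (hH : ∀ k, 1 ≤ k → Hs (k + 1) = (1 / α k) • (y (k + 1) - y k) + γ • y (k + 1))
    (hHd : ∀ k, 1 ≤ k → Hd (k + 1) = δ • Hs (k + 1) + (1 - δ * γ) • y (k + 1))
    (hlam : ∀ k, 1 ≤ k → lam (k + 1) = lam k + (α k * β k) • (A (Zd (k + 1)) + B (Hd (k + 1)) - b))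
    (hstep : ∀ k, 1 ≤ k → ∃ u v,
        (∀ w, f w - f (x (k + 1)) ≥ ⟪u, w - x (k + 1)⟫) ∧
        (∀ w, g w - g (y (k + 1)) ≥ ⟪v, w - y (k + 1)⟫) ∧
        (1 / α k) • (Zs (k + 1) - Zs k) =
          -(β k • (u + (ContinuousLinearMap.adjoint A) (lam (k + 1)) + ε k • x (k + 1)
              - μf • (x (k + 1) - Zd (k + 1)))) ∧
        (1 / α k) • (Hs (k + 1) - Hs k) =
          -(β k • (v + (ContinuousLinearMap.adjoint B) (lam (k + 1)) + ε k • y (k + 1)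
              - μg • (y (k + 1) - Hd (k + 1)))))
    (hδγ : δ * γ - 1 ≥ 0)
    (hββ : ∀ k, 1 ≤ k → δ * β (k + 1) ≤ δ * β k + α k * β k)
    (hεmono : ∀ k, 1 ≤ k → ε (k + 1) ≤ ε k)
    (hsum : Summable (fun k => α k * ε k))
    (hβεtop : Tendsto (fun k => β k * ε k) atTop atTop)
    (xs : X) (ys : Y) (ls : Z)
    (hsaddle : ∀ x' y' l', L xs ys l' ≤ L xs ys ls ∧ L xs ys ls ≤ L x' y' ls)
    (hfeas : A xs + B ys = b)
    (hopt : ∀ x' y', A x' + B y' = b → f xs + g ys ≤ f x' + g y')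
    (hmn : ∀ x' y', A x' + B y' = b →
        (∀ x'' y'', A x'' + B y'' = b → f x' + g y' ≤ f x'' + g y'') →
        ‖xs‖ ^ 2 + ‖ys‖ ^ 2 ≤ ‖x'‖ ^ 2 + ‖y'‖ ^ 2)
    :
    liminf (fun k => Real.sqrt (‖x k - xs‖ ^ 2 + ‖y k - ys‖ ^ 2)) atTop = 0 := by
  have hpos : ∀ k, 1 ≤ k + 1 := fun k => by omega
  obtain ⟨R, hR⟩ : ∃ R : X → Y → Z, R = fun x' y' => A x' + B y' - b := ⟨_, rfl⟩
  obtain ⟨W, hW⟩ : ∃ W : ℕ → X, W = fun k => δ • Zs k + (1 - δ * γ) • x k := ⟨_, rfl⟩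
  obtain ⟨V, hV⟩ : ∃ V : ℕ → Y, V = fun k => δ • Hs k + (1 - δ * γ) • y k := ⟨_, rfl⟩
  obtain ⟨G, hG⟩ : ∃ G : ℕ → ℝ, G = fun k => f (x k) + g (y k) + ⟪ls, R (x k) (y k)⟫
    - (f xs + g ys) := ⟨_, rfl⟩
  obtain ⟨Q, hQ⟩ : ∃ Q : ℕ → ℝ, Q = fun k => (1 / 2 * ‖W k - xs‖ ^ 2
    + (δ * γ - 1) / 2 * ‖x k - xs‖ ^ 2) + (1 / 2 * ‖V k - ys‖ ^ 2
    + (δ * γ - 1) / 2 * ‖y k - ys‖ ^ 2) + δ / 2 * ‖lam k - ls‖ ^ 2 := ⟨_, rfl⟩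
  have hLmin : ∀ x' y', f xs + g ys ≤ f x' + g y' + ⟪ls, R x' y'⟫ := fun x' y' => by
    have h := (hsaddle x' y' ls).2
    rwa [hL, hL, hfeas, sub_self, inner_zero_right, add_zero, ← show R x' y' = A x' + B y' - b by
      rw [hR]] at h
  have hG0 : ∀ k, 0 ≤ G k := fun k => by
    rw [hG]; exact sub_nonneg.2 (hLmin _ _)
  have hQ1 : ∀ k, δ / 2 * ‖lam k - ls‖ ^ 2 ≤ Q k := fun k => by
    rw [hQ]; exact le_add_of_nonneg_left (by positivity)
  have hQ0 : ∀ k, 0 ≤ Q k := fun k => le_trans (by positivity) (hQ1 k)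
  have hWk : ∀ k, 1 ≤ k → W (k + 1) = x (k + 1) + (δ / α k) • (x (k + 1) - x k) := fun k hk => by
    rw [hW]; simp only; rw [hZ k hk, div_eq_mul_one_div]; module
  have hVk : ∀ k, 1 ≤ k → V (k + 1) = y (k + 1) + (δ / α k) • (y (k + 1) - y k) := fun k hk => by
    rw [hV]; simp only; rw [hH k hk, div_eq_mul_one_div]; module
  have hZdW : ∀ k, 1 ≤ k → Zd (k + 1) = W (k + 1) := fun k hk => by rw [hZd k hk, hW]
  have hHdV : ∀ k, 1 ≤ k → Hd (k + 1) = V (k + 1) := fun k hk => by rw [hHd k hk, hV]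
  have hRW : ∀ k, 1 ≤ k → R (W (k + 1)) (V (k + 1)) = R (x (k + 1)) (y (k + 1))
      + (δ / α k) • (R (x (k + 1)) (y (k + 1)) - R (x k) (y k)) := fun k hk => by
    rw [hWk k hk, hVk k hk, hR]
    simp only [map_add, map_smul, map_sub]
    module
  have hlam' : ∀ k, 1 ≤ k → lam (k + 1) - lam k = (α k * β k) • R (W (k + 1)) (V (k + 1)) :=
    fun k hk => by rw [hlam k hk, hZdW k hk, hHdV k hk, hR, add_sub_cancel_left]
  have hstepQ : ∀ k, 1 ≤ k → Q (k + 1) ≤ Q k - δ * α k * β k * (G (k + 1) + ε k / 2 *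
      ((‖x (k + 1)‖ ^ 2 + ‖y (k + 1)‖ ^ 2) - (‖xs‖ ^ 2 + ‖ys‖ ^ 2)))
      - δ ^ 2 * β k * (G (k + 1) - G k + ε k / 2 *
      ((‖x (k + 1)‖ ^ 2 + ‖y (k + 1)‖ ^ 2) - (‖x k‖ ^ 2 + ‖y k‖ ^ 2))) := by
    intro k hk
    have hαk := hα k hk
    obtain ⟨u, v, hu, hv, hx, hy⟩ := hstep k hk
    rw [hZd k hk] at hx
    rw [hHd k hk] at hy
    have h1 := block_energy_step f hαk (hβpos k hk) hδ (hεnn k hk) hμf hδγ xs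
      (fun w => hfS _ w _ hu) (hZ k hk) hx
    have h2 := block_energy_step g hαk (hβpos k hk) hδ (hεnn k hk) hμg hδγ ys
      (fun w => hgS _ w _ hv) (hH k hk) hy
    rw [ContinuousLinearMap.adjoint_inner_left] at h1 h2
    have hWe : ∀ j, δ • Zs j + (1 - δ * γ) • x j = W j := fun j => by rw [hW]
    have hVe : ∀ j, δ • Hs j + (1 - δ * γ) • y j = V j := fun j => by rw [hV]
    simp only [hWe] at h1
    simp only [hVe] at h2
    have hsumR : ⟪lam (k + 1), A (W (k + 1) - xs)⟫ + ⟪lam (k + 1), B (V (k + 1) - ys)⟫ =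
        ⟪lam (k + 1) - ls, R (W (k + 1)) (V (k + 1))⟫ + ⟪ls, R (W (k + 1)) (V (k + 1))⟫ := by
      rw [← inner_add_right, ← inner_add_left, sub_add_cancel, hR, ← hfeas, map_sub, map_sub]
      exact congrArg _ (add_sub_add_comm _ _ _ _).symm
    have hls : δ * α k * β k * ⟪ls, R (W (k + 1)) (V (k + 1))⟫ =
        δ * α k * β k * ⟪ls, R (x (k + 1)) (y (k + 1))⟫ + δ ^ 2 * β k *
        (⟪ls, R (x (k + 1)) (y (k + 1))⟫ - ⟪ls, R (x k) (y k)⟫) := by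
      rw [hRW k hk, inner_add_right, real_inner_smul_right, inner_sub_right]
      field_simp
    have hdual : δ / 2 * ‖lam (k + 1) - ls‖ ^ 2 - δ / 2 * ‖lam k - ls‖ ^ 2 ≤
        δ * α k * β k * ⟪lam (k + 1) - ls, R (W (k + 1)) (V (k + 1))⟫ := by
      have e : lam k - ls = (lam (k + 1) - ls) - (α k * β k) • R (W (k + 1)) (V (k + 1)) := by
        rw [← hlam' k hk]; abel
      rw [e, norm_sub_sq_real (lam (k + 1) - ls), real_inner_smul_right]
      have : 0 ≤ δ / 2 * ‖(α k * β k) • R (W (k + 1)) (V (k + 1))‖ ^ 2 := by positivity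
      linarith
    rw [hQ, hG]
    simp only
    have hsumR' := congrArg (fun t => δ * α k * β k * t) hsumR
    simp only [mul_add] at hsumR'
    linarith
  have hr : ∀ k, 1 ≤ k → ((α k + δ) * β k) • R (x (k + 1)) (y (k + 1)) =
      (δ * β k) • R (x k) (y k) + ((lam (k + 1) - ls) - (lam k - ls)) := by
    intro k hk
    have hαk := hα k hk
    have e : α k * β k * (δ / α k) = δ * β k := by field_simp
    rw [sub_sub_sub_cancel_right, hlam' k hk, hRW k hk, smul_add, smul_smul, e]
    module
  have hββ' : ∀ k, δ * β (k + 1 + 1) ≤ (α (k + 1) + δ) * β (k + 1) := fun k => by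
    linarith [hββ (k + 1) (hpos k)]
  have hε' : Antitone fun k => ε (k + 1) := antitone_nat_of_succ_le fun k => hεmono _ (hpos k)
  have hβ' : Monotone fun k => β (k + 1) := monotone_nat_of_le_succ fun k => hβmono _ (hpos k)
  have hfreq : ∀ η > 0, ∃ᶠ k in atTop,
      ‖x (k + 1)‖ ^ 2 + ‖y (k + 1)‖ ^ 2 < ‖xs‖ ^ 2 + ‖ys‖ ^ 2 + η := fun η hη =>
    frequently_lt_add_of_energy (α := fun k => α (k + 1)) (β := fun k => β (k + 1))
      (ε := fun k => ε (k + 1)) (G := fun k => G (k + 1)) (Q := fun k => Q (k + 1))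
      (N := fun k => ‖x (k + 1)‖ ^ 2 + ‖y (k + 1)‖ ^ 2) hδ (fun k => hα _ (hpos k))
      (fun k => hβpos _ (hpos k)) hββ' (fun k => hεnn _ (hpos k)) hε'
      (hβεtop.comp (tendsto_add_atTop_nat 1)) (fun k => hG0 _) (fun k => hQ0 _)
      (fun k => hstepQ _ (hpos k)) hη
  obtain ⟨hGlim, hRlim⟩ := tendsto_gap_and_residual (α := fun k => α (k + 1))
    (β := fun k => β (k + 1)) (ε := fun k => ε (k + 1)) (G := fun k => G (k + 1))
    (Q := fun k => Q (k + 1)) (N := fun k => ‖x (k + 1)‖ ^ 2 + ‖y (k + 1)‖ ^ 2)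
    (r := fun k => R (x (k + 1)) (y (k + 1))) (s := fun k => lam (k + 1) - ls)
    hδ (fun k => hα _ (hpos k))
    (fun k => hβpos _ (hpos k)) hββ' hβ' (hβtop.comp (tendsto_add_atTop_nat 1))
    (fun k => hεnn _ (hpos k)) hε' ((summable_nat_add_iff 1).2 hsum) (fun k => hG0 _)
    (fun k => by positivity) (by positivity) (fun k => hQ1 _)
    (fun k => hstepQ _ (hpos k)) (fun k => hr _ (hpos k))
  refine liminf_eq_zero_of_frequently_lt (fun k => Real.sqrt_nonneg _) fun η hη => ?_
  obtain ⟨t, ht, hclose⟩ := exists_forall_norm_sub_lt_of_minimal_norm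
    (convexOn_lagrangian_add_norm_residual hfconv hgconv A B b ls (f xs + g ys))
    (by fun_prop) (zs := WithLp.toLp 2 (xs, ys)) (by simp [hfeas])
    (fun z hz => by
      have hLz := hLmin z.fst z.snd
      rw [hR] at hLz
      have hres : ‖A z.fst + B z.snd - b‖ = 0 :=
        le_antisymm (by linarith) (norm_nonneg _)
      have hfz := norm_eq_zero.1 hres
      rw [hfz, inner_zero_right, norm_zero] at hz
      refine le_of_sq_le_sq ?_ (norm_nonneg _)
      rw [WithLp.prod_norm_sq_eq_of_L2, WithLp.prod_norm_sq_eq_of_L2]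
      exact hmn _ _ (sub_eq_zero.1 hfz) fun x'' y'' h'' => by linarith [hopt x'' y'' h'']) hη
  have hev : ∀ᶠ k in atTop, G (k + 1) + ‖R (x (k + 1)) (y (k + 1))‖ < t :=
    (hGlim.add hRlim.norm).eventually_lt_const (by simpa using ht)
  have hfin : ∃ᶠ k in atTop,
      Real.sqrt (‖x (k + 1) - xs‖ ^ 2 + ‖y (k + 1) - ys‖ ^ 2) < η := by
    refine ((hfreq t ht).and_eventually hev).mono fun k hk => ?_
    have h := hclose (WithLp.toLp 2 (x (k + 1), y (k + 1)))
      (by have := hk.2.le; rwa [hG, hR] at this)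
      (by rw [WithLp.prod_norm_sq_eq_of_L2, WithLp.prod_norm_sq_eq_of_L2]; exact hk.1.le)
    rw [← Real.sqrt_sq (norm_nonneg _), WithLp.prod_norm_sq_eq_of_L2] at h
    exact h
  exact (tendsto_add_atTop_nat 1).frequently hfin
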